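/- For every point-shift F and every n ∈ ℕ, the event {0 ∈ F_ω^n(ω)} has positive μ_0-probability and E_{μ_0}[d_n(0) | 0 ∈ F_ω^n(ω)] = 1 / E_{μ_0}[1/l_n(0)], where d_n(0) := #{y ∈ ω : F_ω^n(y) = 0}, l_n(0) := #{y ∈ ω : F_ω^n(y) = F_ω^n(0)}, and F_ω^n(ω) denotes the image of ω under the n-th iterate of F_ω. -/

import Mathlib

open Function Set MeasureTheory ProbabilityTheory
open scoped ENNReal NNReal

namespace PointShift

/-- Points of the grid `ℤ^d`. -/
abbrev Pt (d : ℕ) := Fin d → ℤ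

/-- Configurations: subsets of the grid `ℤ^d`, identified with `{0,1}`-valued
functions, equipped with the product σ-algebra. -/
abbrev Conf (d : ℕ) := Pt d → Bool

/-- The shift `θ_t ω = ω - t`. -/
def shift {d : ℕ} (t : Pt d) (ω : Conf d) : Conf d := fun x => ω (x + t)

/-- The support of a configuration, as a subset of `ℤ^d`. -/
def pts {d : ℕ} (ω : Conf d) : Set (Pt d) := {x | ω x = true}

/-- `g` is a point-map: it is measurable and selects a point of every
configuration having a point at the origin. -/
def IsPointMap {d : ℕ} (g : Conf d → Pt d) : Prop :=
  Measurable g ∧ ∀ ω : Conf d, ω 0 = true → ω (g ω) = true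

/-- The point-shift associated with a point-map `g`: `F_ω x = x + g (θ_x ω)`. -/
def Fps {d : ℕ} (g : Conf d → Pt d) (ω : Conf d) (x : Pt d) : Pt d :=
  x + g (shift x ω)

/-- `μ` is a stationary point process on the grid: a shift-invariant probability
measure with a point at the origin with positive probability. -/
def IsStationaryPP {d : ℕ} (μ : Measure (Conf d)) : Prop :=
  IsProbabilityMeasure μ ∧ (∀ t : Pt d, μ.map (shift t) = μ) ∧
    0 < μ {ω : Conf d | ω 0 = true}

/-- The Palm probability of `μ`: `μ` conditioned on having a point at the origin. -/
noncomputable def Palm {d : ℕ} (μ : Measure (Conf d)) : Measure (Conf d) :=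
  μ[|{ω : Conf d | ω 0 = true}]

/-- The foil of the point `x` in the configuration `ω`, for the point-shift of `g`. -/
def foilOn {d : ℕ} (g : Conf d → Pt d) (ω : Conf d) (x : Pt d) : Set (Pt d) :=
  {y | ω y = true ∧ ∃ n : ℕ, (Fps g ω)^[n] y = (Fps g ω)^[n] x}

/-- The connected component of the point `x` in the functional graph `G^F(ω)`. -/
def compOn {d : ℕ} (g : Conf d → Pt d) (ω : Conf d) (x : Pt d) : Set (Pt d) :=
  {y | ω y = true ∧ ∃ m n : ℕ, (Fps g ω)^[m] x = (Fps g ω)^[n] y}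

/-- `K` is a directed cycle of the functional graph of `f`: a finite set of
distinct points `c 0, …, c (k-1)` (with `k ≥ 1`) such that `f (c i) = c ((i+1) % k)`. -/
def IsCycle {X : Type*} (f : X → X) (K : Set X) : Prop :=
  ∃ (k : ℕ) (c : ℕ → X), 0 < k ∧
    (∀ i < k, ∀ j < k, c i = c j → i = j) ∧
    (∀ i < k, f (c i) = c ((i + 1) % k)) ∧
    K = c '' {i | i < k}

end PointShift

namespace PointShift

variable {d : ℕ} {g : Conf d → Pt d}

theorem measurable_shift (t : Pt d) : Measurable (shift t) :=
  measurable_pi_lambda _ fun x => measurable_pi_apply (x + t)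

theorem measurableSet_mem (x : Pt d) : MeasurableSet {ω : Conf d | ω x = true} :=
  measurableSet_eq_fun (measurable_pi_apply x) measurable_const

theorem shift_shift (s t : Pt d) (ω : Conf d) : shift s (shift t ω) = shift (s + t) ω := by
  funext x
  simp [shift, add_assoc]

/-- Equivariance of the iterates of a point-shift. -/
theorem iterate_Fps_shift (g : Conf d → Pt d) (n : ℕ) (t x : Pt d) (ω : Conf d) :
    (Fps g (shift t ω))^[n] x + t = (Fps g ω)^[n] (x + t) := by
  have h : Semiconj (· + t) (Fps g (shift t ω)) (Fps g ω) := fun x => by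
    simp only [Fps, shift_shift]
    abel
  exact (h.iterate_right n) x

theorem measurable_iterate_Fps (hg : Measurable g) (n : ℕ) (x : Pt d) :
    Measurable fun ω => (Fps g ω)^[n] x := by
  induction n with
  | zero => exact measurable_const
  | succ n ih =>
    simp only [iterate_succ_apply']
    have h : Measurable fun p : Conf d × Pt d => Fps g p.1 p.2 :=
      measurable_from_prod_countable_left fun y =>
        measurable_const.add (hg.comp (measurable_shift y))
    exact h.comp (measurable_id.prodMk ih)

theorem iterate_Fps_mem (hg : IsPointMap g) {ω : Conf d} (n : ℕ) {x : Pt d} (hx : ω x = true) :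
    ω ((Fps g ω)^[n] x) = true := by
  induction n with
  | zero => exact hx
  | succ n ih =>
    rw [iterate_succ_apply']
    have h := hg.2 (shift ((Fps g ω)^[n] x) ω) (by simpa [shift] using ih)
    simpa [shift, Fps, add_comm] using h

/-- The number of points that the `n`-th iterate of the point-shift maps to `x`. -/
noncomputable def fiberCard (g : Conf d → Pt d) (n : ℕ) (x : Pt d) (ω : Conf d) : ℝ≥0∞ :=
  ({y : Pt d | ω y = true ∧ (Fps g ω)^[n] y = x}.encard : ℝ≥0∞)

theorem fiberCard_eq_tsum (n : ℕ) (x : Pt d) (ω : Conf d) :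
    fiberCard g n x ω =
      ∑' y, {ω : Conf d | ω y = true ∧ (Fps g ω)^[n] y = x}.indicator (1 : Conf d → ℝ≥0∞) ω := by
  rw [fiberCard, ← ENNReal.tsum_set_one, tsum_subtype _ (fun _ => (1 : ℝ≥0∞))]
  rfl

theorem measurableSet_iterate_Fps_eq (hg : Measurable g) (n : ℕ) (x y : Pt d) :
    MeasurableSet {ω : Conf d | ω y = true ∧ (Fps g ω)^[n] y = x} :=
  (measurableSet_mem y).inter (measurable_iterate_Fps hg n y (measurableSet_singleton x))

theorem measurable_fiberCard (hg : Measurable g) (n : ℕ) (x : Pt d) :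
    Measurable (fiberCard g n x) := by
  simp only [funext fun ω => fiberCard_eq_tsum (g := g) n x ω]
  exact Measurable.tsum fun y =>
    measurable_one.indicator (measurableSet_iterate_Fps_eq hg n x y)

theorem fiberCard_shift (n : ℕ) (t : Pt d) (ω : Conf d) :
    fiberCard g n 0 (shift t ω) = fiberCard g n t ω := by
  unfold fiberCard
  congr 1
  rw [← (add_left_injective t).encard_image]
  congr 1
  ext y
  simp only [mem_image, mem_ofPred_eq]
  constructor
  · rintro ⟨z, ⟨hz, h⟩, rfl⟩
    exact ⟨hz, by rw [← iterate_Fps_shift, h, zero_add]⟩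
  · rintro ⟨hy, h⟩
    refine ⟨y - t, ⟨by simpa [shift] using hy, ?_⟩, by simp⟩
    have := iterate_Fps_shift g n t (y - t) ω
    rw [sub_add_cancel, h] at this
    simpa using this

/-- Mass transport principle for the iterates of a point-shift. -/
theorem setLIntegral_fiberCard_mul {μ : Measure (Conf d)}
    (hinv : ∀ t : Pt d, μ.map (shift t) = μ) (hg : IsPointMap g) (n : ℕ)
    {u : Conf d → ℝ≥0∞} (hu : Measurable u) :
    ∫⁻ ω in {ω | ω 0 = true}, fiberCard g n 0 ω * u ω ∂μ =
      ∫⁻ ω in {ω | ω 0 = true}, u (shift ((Fps g ω)^[n] 0) ω) ∂μ := by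
  let S : Pt d → Set (Conf d) := fun y =>
    {ω | ω 0 = true} ∩ {ω : Conf d | ω y = true ∧ (Fps g ω)^[n] y = 0}
  let T : Pt d → Set (Conf d) := fun y => {ω : Conf d | ω 0 = true ∧ (Fps g ω)^[n] 0 = y}
  have hS (y) : MeasurableSet (S y) :=
    (measurableSet_mem 0).inter (measurableSet_iterate_Fps_eq hg.1 n 0 y)
  have hT (y) : MeasurableSet (T y) := measurableSet_iterate_Fps_eq hg.1 n y 0
  have hST (y : Pt d) (ω : Conf d) : shift (-y) ω ∈ S y ↔ ω ∈ T (-y) := by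
    have h := iterate_Fps_shift g n (-y) y ω
    rw [add_neg_cancel] at h
    simp only [S, T, mem_inter_iff, mem_ofPred_eq, shift, zero_add, add_neg_cancel, ← h,
      add_eq_right]
    refine ⟨fun h' => h'.2, fun h' => ⟨?_, h'⟩⟩
    have := iterate_Fps_mem hg n h'.1
    rwa [← h, h'.2, zero_add] at this
  have hleft : ∫⁻ ω in {ω | ω 0 = true}, fiberCard g n 0 ω * u ω ∂μ =
      ∑' y, ∫⁻ ω, (S y).indicator u ω ∂μ := by
    rw [← lintegral_indicator (measurableSet_mem 0),
      ← lintegral_tsum fun y => (hu.indicator (hS y)).aemeasurable]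
    congr 1 with ω
    by_cases h0 : ω 0 = true
    · rw [indicator_of_mem (by exact h0), fiberCard_eq_tsum, ← ENNReal.tsum_mul_right]
      congr 1 with y
      simp [S, indicator, h0]
    · simp [S, indicator, h0]
  have hright : ∫⁻ ω in {ω | ω 0 = true}, u (shift ((Fps g ω)^[n] 0) ω) ∂μ =
      ∑' y, ∫⁻ ω, (T y).indicator (fun ω => u (shift y ω)) ω ∂μ := by
    rw [← lintegral_indicator (measurableSet_mem 0),
      ← lintegral_tsum fun y =>
        (Measurable.indicator (f := fun ω => u (shift y ω)) (hu.comp (measurable_shift y))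
          (hT y)).aemeasurable]
    congr 1 with ω
    rw [tsum_eq_single ((Fps g ω)^[n] 0)]
    · simp [T, indicator]
    · intro y hy
      simp [T, indicator, hy.symm]
  rw [hleft, hright, ← (Equiv.neg (Pt d)).tsum_eq]
  congr 1 with y
  conv_lhs => rw [← hinv y]
  rw [Equiv.neg_apply, lintegral_map (hu.indicator (hS (-y))) (measurable_shift _)]
  congr 1 with ω
  have h := hST (-y) ω
  rw [neg_neg] at h
  simp only [indicator, h]

theorem fiberCard_ne_zero_iff (n : ℕ) (x : Pt d) (ω : Conf d) :
    fiberCard g n x ω ≠ 0 ↔ x ∈ (Fps g ω)^[n] '' pts ω := by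
  simp only [fiberCard, ne_eq, ENat.toENNReal_eq_zero, encard_eq_zero]
  rw [← ne_eq, ← nonempty_iff_ne_empty]
  rfl

theorem lintegral_palm_fiberCard_mul {μ : Measure (Conf d)}
    (hinv : ∀ t : Pt d, μ.map (shift t) = μ) (hg : IsPointMap g) (n : ℕ)
    {u : Conf d → ℝ≥0∞} (hu : Measurable u) :
    ∫⁻ ω, fiberCard g n 0 ω * u ω ∂(Palm μ) =
      ∫⁻ ω, u (shift ((Fps g ω)^[n] 0) ω) ∂(Palm μ) := by
  simp only [Palm, ProbabilityTheory.cond, lintegral_smul_measure,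
    setLIntegral_fiberCard_mul hinv hg n hu]

end PointShift

/-- The event `{0 ∈ F^n(ω)}` has positive `μ₀`-probability and the
conditional Palm expectation of `d_n(0)` given this event equals `1 / E_{μ₀}[1/l_n(0)]`. -/
theorem stmt_18 {d : ℕ} (hd : 0 < d)
    (μ : Measure (PointShift.Conf d)) [IsProbabilityMeasure μ]
    (hinv : ∀ t : PointShift.Pt d, μ.map (PointShift.shift t) = μ)
    (hpos : 0 < μ {ω : PointShift.Conf d | ω 0 = true})
    (g : PointShift.Conf d → PointShift.Pt d) (hg : PointShift.IsPointMap g)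
    (n : ℕ) :
    0 < PointShift.Palm μ {ω : PointShift.Conf d |
        0 ∈ (PointShift.Fps g ω)^[n] '' PointShift.pts ω} ∧
    ∫⁻ ω, ({y : PointShift.Pt d | ω y = true ∧
          (PointShift.Fps g ω)^[n] y = 0}.encard : ℝ≥0∞)
        ∂((PointShift.Palm μ)[|{ω : PointShift.Conf d |
          0 ∈ (PointShift.Fps g ω)^[n] '' PointShift.pts ω}])
      = (∫⁻ ω, (({y : PointShift.Pt d | ω y = true ∧
          (PointShift.Fps g ω)^[n] y = (PointShift.Fps g ω)^[n] 0}.encard : ℝ≥0∞))⁻¹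
          ∂(PointShift.Palm μ))⁻¹ := by
  have hpalm : IsProbabilityMeasure (PointShift.Palm μ) := cond_isProbabilityMeasure hpos.ne'
  have hmeas := PointShift.measurable_fiberCard hg.1 n 0
  have hB : {ω : PointShift.Conf d | 0 ∈ (PointShift.Fps g ω)^[n] '' PointShift.pts ω} =
      {ω | PointShift.fiberCard g n 0 ω ≠ 0} := by
    ext ω
    exact (PointShift.fiberCard_ne_zero_iff n 0 ω).symm
  have hBm : MeasurableSet {ω | PointShift.fiberCard g n 0 ω ≠ 0} :=
    hmeas (measurableSet_singleton 0).compl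
  have hone : ∫⁻ ω, PointShift.fiberCard g n 0 ω ∂(PointShift.Palm μ) = 1 := by
    simpa using PointShift.lintegral_palm_fiberCard_mul hinv hg n (u := 1) measurable_one
  have hfin : ∀ᵐ ω ∂(PointShift.Palm μ), PointShift.fiberCard g n 0 ω < ∞ :=
    ae_lt_top hmeas (by simp [hone])
  have hprob : PointShift.Palm μ {ω | PointShift.fiberCard g n 0 ω ≠ 0} =
      ∫⁻ ω, (PointShift.fiberCard g n ((PointShift.Fps g ω)^[n] 0) ω)⁻¹ ∂(PointShift.Palm μ) := by
    have h := PointShift.lintegral_palm_fiberCard_mul hinv hg n hmeas.inv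
    simp only [Pi.inv_apply, PointShift.fiberCard_shift] at h
    rw [← h, ← lintegral_indicator_one hBm]
    refine lintegral_congr_ae ?_
    filter_upwards [hfin] with ω hω
    by_cases h0 : PointShift.fiberCard g n 0 ω = 0
    · simp [h0]
    · simp [indicator, h0, ENNReal.mul_inv_cancel h0 hω.ne]
  rw [hB]
  constructor
  · rw [pos_iff_ne_zero]
    intro h
    have h0 : PointShift.fiberCard g n 0 =ᵐ[PointShift.Palm μ] 0 := h
    rw [lintegral_congr_ae h0] at hone
    simp at hone
  · change ∫⁻ ω, PointShift.fiberCard g n 0 ω ∂_ = (∫⁻ ω,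
      (PointShift.fiberCard g n ((PointShift.Fps g ω)^[n] 0) ω)⁻¹ ∂(PointShift.Palm μ))⁻¹
    rw [← hprob, ProbabilityTheory.cond, lintegral_smul_measure, ← lintegral_indicator hBm]
    have : {ω | PointShift.fiberCard g n 0 ω ≠ 0}.indicator (PointShift.fiberCard g n 0) =
        PointShift.fiberCard g n 0 := indicator_support
    rw [this, hone, smul_eq_mul, mul_one]
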